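/- arXiv:1703.04154 — 4 statements merged into one kernel-verified Lean document; each statement's English description precedes it below -/
import Mathlib

section
/- Suppose G is a normal subgroup of the direct product G₁ × ⋯ × Gₙ such that each projection map πᵢ : G → Gᵢ is surjective (1 ≤ i ≤ n). Then the quotient group (G₁ × ⋯ × Gₙ)/G is abelian; equivalently, G contains the commutator subgroup of G₁ × ⋯ × Gₙ. -/
open scoped commutatorElement in
/-- A commutator with a `Pi.mulSingle i x` depends only on the `i`-th coordinate of the other
entry. -/
theorem Pi.commutatorElement_mulSingle_congr {ι : Type*} [DecidableEq ι] {G : ι → Type*}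
    [∀ i, Group (G i)] {i : ι} (x : G i) {b c : ∀ i, G i} (h : b i = c i) :
    ⁅Pi.mulSingle i x, b⁆ = ⁅Pi.mulSingle i x, c⁆ := by
  ext j
  obtain rfl | hj := eq_or_ne j i
  · simp [commutatorElement_def, h]
  · simp [commutatorElement_def, Pi.mulSingle_eq_of_ne hj]

/-- A normal subgroup of a finite direct product that surjects onto every factor contains the
commutator subgroup. -/
theorem Subgroup.commutator_pi_le_of_surjective {ι : Type*} [Finite ι] {G : ι → Type*}
    [∀ i, Group (G i)] (H : Subgroup (∀ i, G i)) [H.Normal]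
    (hsurj : ∀ i, Function.Surjective fun g : H => (g : ∀ j, G j) i) :
    _root_.commutator (∀ i, G i) ≤ H := by
  classical
  have mem_center (a : ∀ i, G i) :
      a ∈ (center ((∀ i, G i) ⧸ H)).comap (QuotientGroup.mk' H) := by
    refine pi_mem_of_mulSingle_mem a fun i => ?_
    rw [mem_comap, mem_center_iff]
    intro q
    obtain ⟨b, rfl⟩ := QuotientGroup.mk'_surjective H q
    obtain ⟨h, hh⟩ := hsurj i (b i)
    refine (commutatorElement_eq_one_iff_mul_comm.mp ?_).symm
    rw [← map_commutatorElement, ← Pi.commutatorElement_mulSingle_congr (a i) hh,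
      map_commutatorElement, QuotientGroup.mk'_apply H h.1, (QuotientGroup.eq_one_iff _).mpr h.2,
      commutatorElement_one_right]
  rw [_root_.commutator_def, commutator_le]
  intro a _ b _
  rw [← QuotientGroup.eq_one_iff, ← QuotientGroup.mk'_apply, map_commutatorElement,
    commutatorElement_eq_one_iff_mul_comm]
  exact mem_center_iff.mp (mem_center b) _

/-- Suppose `G` is a normal subgroup of the direct product
`G₁ × ⋯ × Gₙ` such that each projection map `πᵢ : G → Gᵢ` is surjective.  Then the
quotient group `(G₁ × ⋯ × Gₙ)/G` is abelian; equivalently, `G` contains the commutator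
subgroup of `G₁ × ⋯ × Gₙ`. -/
theorem stmt4 {n : ℕ} (G : Fin n → Type*) [∀ i, Group (G i)]
    (H : Subgroup (∀ i, G i)) [H.Normal]
    (hsurj : ∀ i, Function.Surjective fun g : H => (g : ∀ j, G j) i) :
    (∀ a b : (∀ i, G i) ⧸ H, a * b = b * a) ∧
      commutator (∀ i, G i) ≤ H := by
  have hle := H.commutator_pi_le_of_surjective hsurj
  exact ⟨(Subgroup.Normal.quotient_commutative_iff_commutator_le.mpr hle).is_comm.comm, hle⟩
end

section
/- Let L/K be a finite Galois extension of fields and let L₁, L₂ be intermediate fields of L/K, each Galois over K, with L equal to the compositum L₁L₂. Identify Gal(L/K) with its image G in Gal(L₁/K) × Gal(L₂/K) under the (injective) restriction map. Then G is a normal subgroup of Gal(L₁/K) × Gal(L₂/K) if and only if the Galois group Gal((L₁ ∩ L₂)/K) is abelian, i.e. if and only if L₁ ∩ L₂ is an abelian extension of K. -/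
theorem MonoidHom.map_mem_range_prod_iff {G A B Q : Type*} [Group G] [Group A] [Group B] [Group Q]
    (f₁ : G →* A) (f₂ : G →* B) (q : G →* Q) (hq : q.ker = f₁.ker ⊔ f₂.ker) (g h : G) :
    (f₁ g, f₂ h) ∈ (f₁.prod f₂).range ↔ q g = q h := by
  rw [MonoidHom.eq_iff, hq, Subgroup.mem_sup_of_normal_left]
  simp only [MonoidHom.mem_range, MonoidHom.prod_apply, Prod.mk.injEq]
  constructor
  · rintro ⟨k, hg, hh⟩
    refine ⟨h⁻¹ * g * (h⁻¹ * k)⁻¹, ?_, h⁻¹ * k, ?_, by group⟩ <;>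
      simp [MonoidHom.mem_ker, hg, hh]
  · rintro ⟨y, hy, z, hz, hyz⟩
    rw [MonoidHom.mem_ker] at hy hz
    refine ⟨h * z, ?_, by simp [hz]⟩
    have := congrArg f₁ hyz
    simp only [map_mul, hy, one_mul, map_inv] at this
    simp [this]

theorem MonoidHom.normal_range_prod_iff {G A B Q : Type*} [Group G] [Group A] [Group B] [Group Q]
    {f₁ : G →* A} {f₂ : G →* B} {q : G →* Q} (h₁ : Function.Surjective f₁)
    (h₂ : Function.Surjective f₂) (hq : Function.Surjective q) (hker : q.ker = f₁.ker ⊔ f₂.ker) :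
    (f₁.prod f₂).range.Normal ↔ ∀ σ τ : Q, σ * τ = τ * σ := by
  constructor
  · intro hN σ τ
    obtain ⟨g, rfl⟩ := hq σ
    obtain ⟨x, rfl⟩ := hq τ
    have hx := hN.conj_mem (f₁ x, f₂ x) ⟨x, rfl⟩ (f₁ g, f₂ 1)
    simp only [Prod.mk_mul_mk, Prod.inv_mk, ← map_mul, ← map_inv] at hx
    rw [MonoidHom.map_mem_range_prod_iff f₁ f₂ q hker] at hx
    simpa [mul_inv_eq_iff_eq_mul] using hx
  · intro hQ
    refine ⟨?_⟩
    rintro _ ⟨x, rfl⟩ ⟨a, b⟩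
    obtain ⟨g, rfl⟩ := h₁ a
    obtain ⟨h, rfl⟩ := h₂ b
    simp only [MonoidHom.prod_apply, Prod.mk_mul_mk, Prod.inv_mk, ← map_mul, ← map_inv]
    rw [MonoidHom.map_mem_range_prod_iff f₁ f₂ q hker]
    simp [hQ (q g) (q x), hQ (q h) (q x)]

theorem IntermediateField.fixingSubgroup_inf {K L : Type*} [Field K] [Field L] [Algebra K L]
    [FiniteDimensional K L] [IsGalois K L] (L₁ L₂ : IntermediateField K L) :
    (L₁ ⊓ L₂).fixingSubgroup = L₁.fixingSubgroup ⊔ L₂.fixingSubgroup :=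
  congrArg OrderDual.ofDual
    ((IsGalois.intermediateFieldEquivSubgroup (F := K) (E := L)).map_inf L₁ L₂)


/-- Let `L/K` be a finite Galois extension and `L₁, L₂` intermediate
fields, each Galois over `K`, with compositum `L`.  Identify `Gal(L/K)` with its image
`G` in `Gal(L₁/K) × Gal(L₂/K)` under the restriction map.  Then `G` is normal in
`Gal(L₁/K) × Gal(L₂/K)` if and only if `Gal((L₁ ∩ L₂)/K)` is abelian, i.e. `L₁ ∩ L₂`
is an abelian extension of `K`. -/
theorem stmt9 (K L : Type*) [Field K] [Field L] [Algebra K L]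
    [FiniteDimensional K L] [IsGalois K L]
    (L₁ L₂ : IntermediateField K L) [IsGalois K L₁] [IsGalois K L₂]
    (hcomp : L₁ ⊔ L₂ = ⊤) :
    ((AlgEquiv.restrictNormalHom (F := K) (K₁ := L) L₁).prod
        (AlgEquiv.restrictNormalHom (F := K) (K₁ := L) L₂)).range.Normal ↔
      ∀ σ τ : (↥(L₁ ⊓ L₂) ≃ₐ[K] ↥(L₁ ⊓ L₂)), σ * τ = τ * σ := by
  refine MonoidHom.normal_range_prod_iff
    (q := AlgEquiv.restrictNormalHom (F := K) (K₁ := L) ↥(L₁ ⊓ L₂))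
    (AlgEquiv.restrictNormalHom_surjective L) (AlgEquiv.restrictNormalHom_surjective L)
    (AlgEquiv.restrictNormalHom_surjective L) ?_
  simp only [IntermediateField.restrictNormalHom_ker, IntermediateField.fixingSubgroup_inf]
end

section
/- Let ℓ be a prime number. The number of matrices A ∈ GL₂(ℤ/ℓℤ) satisfying det(I − A) = 0 (equivalently, matrices having 1 as an eigenvalue) equals ℓ² + (ℓ − 2)(ℓ² + ℓ), i.e. ℓ³ − 2ℓ. Consequently, the proportion of A ∈ GL₂(ℤ/ℓℤ) with det(I − A) ∈ (ℤ/ℓℤ)ˣ equals 1 − (ℓ² + (ℓ−2)(ℓ²+ℓ))/((ℓ² − ℓ)(ℓ² − 1)). -/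
section FiniteFieldCount

variable {F : Type*} [Field F] [Fintype F] [DecidableEq F]

/-- The number of solutions of `b * c = k` over a finite field. -/
lemma sum_sum_ite_mul_eq (k : F) :
    ∑ b : F, ∑ c : F, (if k = b * c then (1 : ℤ) else 0) =
      (Fintype.card F - 1) + if k = 0 then (Fintype.card F : ℤ) else 0 := by
  have inner (b : F) : ∑ c : F, (if k = b * c then (1 : ℤ) else 0) =
      1 + if b = 0 then (if k = 0 then (Fintype.card F : ℤ) else 0) - 1 else 0 := by
    by_cases hb : b = 0
    · by_cases hk : k = 0 <;> simp [hb, hk]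
    · have hc (c : F) : k = b * c ↔ c = k / b := by
        rw [eq_div_iff hb, mul_comm, eq_comm]
      simp [hb, hc]
  simp only [inner, Finset.sum_add_distrib, Finset.sum_ite_eq', Finset.mem_univ, if_true,
    Finset.sum_const, Finset.card_univ, nsmul_eq_mul, mul_one]
  ring

/-- The number of singular `2 × 2` matrices of trace different from `1` over a finite field. -/
lemma card_mul_eq_mul_and_add_ne_one :
    (Nat.card {p : F × F × F × F // p.1 * p.2.1 = p.2.2.1 * p.2.2.2 ∧ p.1 + p.2.1 ≠ 1} : ℤ) =
      (Fintype.card F : ℤ) ^ 3 - 2 * Fintype.card F := by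
  have fiber (x y : F) :
      ∑ b : F, ∑ c : F, (if x * y = b * c ∧ x + y ≠ 1 then (1 : ℤ) else 0) =
        (1 - if y = 1 - x then 1 else 0) *
          ((Fintype.card F - 1) + if x * y = 0 then (Fintype.card F : ℤ) else 0) := by
    have hy : y = 1 - x ↔ x + y = 1 := by rw [eq_sub_iff_add_eq, add_comm]
    rw [← sum_sum_ite_mul_eq]
    by_cases h : x + y = 1 <;> simp [hy, h]
  have zero_product : ∑ x : F, ∑ y : F, (if x * y = 0 then (Fintype.card F : ℤ) else 0) =
      Fintype.card F * (2 * Fintype.card F - 1) := by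
    have h := sum_sum_ite_mul_eq (0 : F)
    simp only [if_true] at h
    rw [show (2 * Fintype.card F - 1 : ℤ) = Fintype.card F - 1 + Fintype.card F by ring, ← h]
    simp only [Finset.mul_sum, mul_ite, mul_one, mul_zero, eq_comm (a := (0 : F))]
  have idempotent : ∑ x : F, (if x * (1 - x) = 0 then (Fintype.card F : ℤ) else 0) =
      Fintype.card F * 2 := by
    have h (x : F) : (if x * (1 - x) = 0 then (Fintype.card F : ℤ) else 0) =
        (if x = 0 then (Fintype.card F : ℤ) else 0) +
          if x = 1 then (Fintype.card F : ℤ) else 0 := by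
      by_cases h₀ : x = 0
      · simp [h₀]
      · simp [h₀, sub_eq_zero, eq_comm (a := (1 : F))]
    simp only [h, Finset.sum_add_distrib, Finset.sum_ite_eq', Finset.mem_univ, if_true]
    ring
  rw [Nat.card_eq_fintype_card, Fintype.card_subtype, Finset.card_filter]
  push_cast
  simp only [Fintype.sum_prod_type, fiber]
  simp only [sub_mul, one_mul, ite_mul, zero_mul, Finset.sum_sub_distrib, Finset.sum_add_distrib,
    Finset.sum_ite_eq', Finset.mem_univ, if_true, zero_product, idempotent,
    Finset.sum_const, Finset.card_univ, nsmul_eq_mul]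
  ring

end FiniteFieldCount

/-- Invertible `2 × 2` matrices with eigenvalue `1` correspond to singular matrices of trace
different from `1`, via `A ↦ 1 - A` up to the sign of the off-diagonal entries. -/
lemma card_GL_two_det_one_sub_eq_zero_eq (F : Type*) [Field F] :
    Nat.card {A : GL (Fin 2) F // Matrix.det (1 - (A : Matrix (Fin 2) (Fin 2) F)) = 0} =
      Nat.card {p : F × F × F × F //
        p.1 * p.2.1 = p.2.2.1 * p.2.2.2 ∧ p.1 + p.2.1 ≠ 1} := by
  refine Nat.card_congr (Equiv.ofBijective (fun A ↦
    ⟨(1 - A.1.1 0 0, 1 - A.1.1 1 1, A.1.1 0 1, A.1.1 1 0), ?_, ?_⟩) ⟨?_, ?_⟩)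
  · have h := A.2
    simp only [Matrix.det_fin_two, Matrix.sub_apply, Matrix.one_apply] at h
    simp at h
    linear_combination h
  · intro ht
    have h := A.2
    simp only [Matrix.det_fin_two, Matrix.sub_apply, Matrix.one_apply] at h
    simp at h
    have hd : A.1.1.det ≠ 0 := ((Matrix.isUnit_iff_isUnit_det _).1 A.1.isUnit).ne_zero
    rw [Matrix.det_fin_two] at hd
    exact hd (by linear_combination h - ht)
  · rintro ⟨A, hA⟩ ⟨B, hB⟩ h
    simp only [Subtype.mk.injEq, Prod.mk.injEq, sub_right_inj] at h
    obtain ⟨h₀₀, h₁₁, h₀₁, h₁₀⟩ := h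
    apply Subtype.ext
    apply Units.ext
    ext i j
    fin_cases i <;> fin_cases j <;> assumption
  · rintro ⟨⟨x, y, b, c⟩, h, ht⟩
    simp only at h ht
    have hd : Matrix.det !![1 - x, b; c, 1 - y] ≠ 0 := by
      rw [Matrix.det_fin_two_of]
      intro h₀
      exact ht (by linear_combination h - h₀)
    refine ⟨⟨Matrix.GeneralLinearGroup.mkOfDetNeZero _ hd, ?_⟩, ?_⟩
    · simp [Matrix.GeneralLinearGroup.mkOfDetNeZero, Matrix.det_fin_two, h]
    · simp [Matrix.GeneralLinearGroup.mkOfDetNeZero]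


/-- Let `ℓ` be a prime.  The number of matrices `A ∈ GL₂(ℤ/ℓℤ)` with
`det(I - A) = 0` (i.e. having `1` as an eigenvalue) equals `ℓ² + (ℓ-2)(ℓ² + ℓ)`
(that is, `ℓ³ - 2ℓ`).  Consequently, the proportion of `A ∈ GL₂(ℤ/ℓℤ)` with
`det(I - A) ∈ (ℤ/ℓℤ)ˣ` equals `1 - (ℓ² + (ℓ-2)(ℓ²+ℓ)) / ((ℓ² - ℓ)(ℓ² - 1))`. -/
theorem stmt11 (ℓ : ℕ) (hℓ : ℓ.Prime) :
    Nat.card {A : GL (Fin 2) (ZMod ℓ) //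
        Matrix.det (1 - (A : Matrix (Fin 2) (Fin 2) (ZMod ℓ))) = 0} =
      ℓ ^ 2 + (ℓ - 2) * (ℓ ^ 2 + ℓ) ∧
    (Nat.card {A : GL (Fin 2) (ZMod ℓ) //
          IsUnit (Matrix.det (1 - (A : Matrix (Fin 2) (Fin 2) (ZMod ℓ))))} : ℚ) /
        (Nat.card (GL (Fin 2) (ZMod ℓ)) : ℚ) =
      1 - ((ℓ : ℚ) ^ 2 + ((ℓ : ℚ) - 2) * ((ℓ : ℚ) ^ 2 + (ℓ : ℚ))) /
          (((ℓ : ℚ) ^ 2 - (ℓ : ℚ)) * ((ℓ : ℚ) ^ 2 - 1)) := by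
  have : Fact ℓ.Prime := ⟨hℓ⟩
  have two_le := hℓ.two_le
  have hcount : (Nat.card {A : GL (Fin 2) (ZMod ℓ) //
      Matrix.det (1 - (A : Matrix (Fin 2) (Fin 2) (ZMod ℓ))) = 0} : ℤ) =
        (ℓ : ℤ) ^ 3 - 2 * ℓ := by
    rw [card_GL_two_det_one_sub_eq_zero_eq, card_mul_eq_mul_and_add_ne_one, ZMod.card]
  have hGL : (Nat.card (GL (Fin 2) (ZMod ℓ)) : ℚ) =
      ((ℓ : ℚ) ^ 2 - ℓ) * ((ℓ : ℚ) ^ 2 - 1) := by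
    rw [Matrix.card_GL_field, Fin.prod_univ_two, ZMod.card]
    have h₁ : ℓ ^ 0 ≤ ℓ ^ 2 := Nat.pow_le_pow_right (by lia) (by lia)
    have h₂ : ℓ ^ 1 ≤ ℓ ^ 2 := Nat.pow_le_pow_right (by lia) (by lia)
    simp only [Fin.val_zero, Fin.val_one]
    push_cast [Nat.cast_sub h₁, Nat.cast_sub h₂]
    ring
  constructor
  · zify [two_le]
    rw [hcount]
    ring
  · have hsum : Nat.card {A : GL (Fin 2) (ZMod ℓ) //
          Matrix.det (1 - (A : Matrix (Fin 2) (Fin 2) (ZMod ℓ))) = 0} +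
        Nat.card {A : GL (Fin 2) (ZMod ℓ) //
          IsUnit (Matrix.det (1 - (A : Matrix (Fin 2) (Fin 2) (ZMod ℓ))))} =
        Nat.card (GL (Fin 2) (ZMod ℓ)) := by
      classical
      simp only [isUnit_iff_ne_zero]
      rw [← Nat.card_sum, Nat.card_congr (Equiv.sumCompl _)]
    have hcount' : (Nat.card {A : GL (Fin 2) (ZMod ℓ) //
        Matrix.det (1 - (A : Matrix (Fin 2) (Fin 2) (ZMod ℓ))) = 0} : ℚ) =
          (ℓ : ℚ) ^ 3 - 2 * ℓ := mod_cast hcount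
    have hne : (Nat.card (GL (Fin 2) (ZMod ℓ)) : ℚ) ≠ 0 := mod_cast Nat.card_pos.ne'
    rw [← hGL, eq_sub_iff_add_eq, ← add_div, div_eq_one_iff_eq hne, ← hsum]
    push_cast
    rw [hcount']
    ring
end

section
/- Let ℓ be an odd prime. Then Σ_{A} (det A / ℓ) = −ℓ, where the sum runs over all matrices A ∈ GL₂(ℤ/ℓℤ) with det(I − A) = 0 and (· / ℓ) denotes the Legendre symbol modulo ℓ. Equivalently, the sum of (det A / ℓ) over all A ∈ GL₂(ℤ/ℓℤ) with det(I − A) ≠ 0 equals ℓ. -/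
section CharacterSums

variable {F : Type*} [Field F] [Fintype F] [DecidableEq F]

/-- A translated and reflected sum of a nontrivial quadratic character vanishes. -/
theorem sum_quadraticChar_sub_eq_zero (hF : ringChar F ≠ 2) (t : F) :
    ∑ x : F, quadraticChar F (t - x) = 0 := by
  rw [← quadraticChar_sum_zero hF]
  exact Equiv.sum_comp (Equiv.subLeft t) (fun x => quadraticChar F x)

/-- The quadratic character of `1 - a - d`, summed over the cross `a * d = 0`. -/
theorem sum_quadraticChar_cross (hF : ringChar F ≠ 2) :
    ∑ a : F, ∑ d : F, (if a * d = 0 then quadraticChar F (1 - a - d) else 0) = -1 := by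
  have key : ∀ a : F, ∑ d : F, (if a * d = 0 then quadraticChar F (1 - a - d) else 0)
      = quadraticChar F (1 - a) - (if a = 0 then 1 else 0) := by
    intro a
    by_cases ha : a = 0
    · simpa [ha, -quadraticChar_apply] using sum_quadraticChar_sub_eq_zero hF 1
    · simp [ha]
  simp only [key, Finset.sum_sub_distrib, sum_quadraticChar_sub_eq_zero hF]
  simp

/-- The quadratic character of `1 - a - d`, summed over all singular matrices `!![a, b; c, d]`. -/
theorem sum_quadraticChar_singular (hF : ringChar F ≠ 2) :
    ∑ b : F, ∑ a : F, ∑ d : F, ∑ c : F,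
      (if a * d = b * c then quadraticChar F (1 - a - d) else 0) = -(Fintype.card F : ℤ) := by
  have key : ∀ b : F, ∑ a : F, ∑ d : F, ∑ c : F,
      (if a * d = b * c then quadraticChar F (1 - a - d) else 0)
      = if b = 0 then -(Fintype.card F : ℤ) else 0 := by
    intro b
    by_cases hb : b = 0
    · simp only [hb, zero_mul, Finset.sum_const, Finset.card_univ, if_true, ← Finset.smul_sum,
        sum_quadraticChar_cross hF]
      simp
    · have hc : ∀ a d c : F, a * d = b * c ↔ a * d / b = c := fun a d c => by
        rw [div_eq_iff hb, mul_comm c b]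
      simp only [hc, hb, Finset.sum_ite_eq, Finset.mem_univ, if_true, if_false,
        sum_quadraticChar_sub_eq_zero hF, Finset.sum_const_zero]
  simp only [key, Finset.sum_ite_eq', Finset.mem_univ, if_true]

/-- Over `GL₂(F)`, the quadratic character of the determinant sums to zero. -/
theorem sum_quadraticChar_det_GL_two (hF : ringChar F ≠ 2) :
    ∑ A : GL (Fin 2) F, quadraticChar F (Matrix.det (A : Matrix (Fin 2) (Fin 2) F)) = 0 := by
  let f : GL (Fin 2) F →* ℤ :=
    (quadraticChar F).toMonoidHom.comp ((Units.coeHom F).comp Matrix.GeneralLinearGroup.det)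
  refine sum_hom_units_eq_zero f fun hf => ?_
  obtain ⟨u, hu⟩ := quadraticChar_exists_neg_one hF
  have hu0 : u ≠ 0 := by
    rintro rfl
    simp at hu
  have h := DFunLike.congr_fun hf
    (Matrix.GeneralLinearGroup.mkOfDetNeZero !![u, 0; 0, 1] (by simpa using hu0))
  have h' : quadraticChar F (Matrix.det !![u, 0; 0, 1]) = 1 := h
  simp [hu] at h'

/-- The quadratic character of the determinant, summed over the elements of `GL₂(F)` with
eigenvalue `1`. -/
theorem sum_quadraticChar_det_GL_two_eigenvalue_one (hF : ringChar F ≠ 2) :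
    ∑ A ∈ Finset.univ.filter
        (fun A : GL (Fin 2) F => Matrix.det (1 - (A : Matrix (Fin 2) (Fin 2) F)) = 0),
      quadraticChar F (Matrix.det (A : Matrix (Fin 2) (Fin 2) F)) = -(Fintype.card F : ℤ) := by
  rw [← sum_quadraticChar_singular hF]
  simp only [← Fintype.sum_prod_type']
  rw [← Finset.sum_filter]
  refine Finset.sum_of_injOn (fun A : GL (Fin 2) F => (A 0 1, 1 - A 0 0, 1 - A 1 1, A 1 0))
    ?_ ?_ ?_ ?_
  · intro A _ B _ h
    simp only [Prod.mk.injEq, sub_right_inj] at h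
    ext i j
    fin_cases i <;> fin_cases j <;> simp [h]
  · intro A hA
    simp only [Finset.coe_filter, Finset.mem_univ, true_and, Set.mem_ofPred_eq,
      Matrix.det_fin_two, Matrix.sub_apply, Matrix.one_apply] at hA ⊢
    simp at hA
    linear_combination hA
  · rintro ⟨b, a, d, c⟩ hx hn
    simp only [Finset.mem_filter, Finset.mem_univ, true_and] at hx
    by_contra h0
    have h1 : 1 - a - d ≠ 0 := fun h => h0 (by simp [h])
    refine hn ⟨Matrix.GeneralLinearGroup.mkOfDetNeZero !![1 - a, b; c, 1 - d] ?_, ?_, ?_⟩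
    · rw [Matrix.det_fin_two_of]
      convert h1 using 1
      linear_combination hx
    · simp [Matrix.GeneralLinearGroup.mkOfDetNeZero, Matrix.det_fin_two]
      linear_combination hx
    · simp [Matrix.GeneralLinearGroup.mkOfDetNeZero]
  · intro A hA
    simp only [Finset.mem_filter, Finset.mem_univ, true_and, Matrix.det_fin_two,
      Matrix.sub_apply, Matrix.one_apply] at hA
    simp at hA
    rw [Matrix.det_fin_two]
    congr 1
    linear_combination hA

end CharacterSums

/-- Let `ℓ` be an odd prime.  Then the sum of the Legendre symbol
`(det A / ℓ)` (realised as the quadratic character of `ℤ/ℓℤ`) over all matrices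
`A ∈ GL₂(ℤ/ℓℤ)` with `det(I - A) = 0` equals `-ℓ`; equivalently, the sum of
`(det A / ℓ)` over all `A ∈ GL₂(ℤ/ℓℤ)` with `det(I - A) ≠ 0` equals `ℓ`. -/
theorem stmt12 (ℓ : ℕ) [Fact ℓ.Prime] (hodd : ℓ ≠ 2) :
    (∑ A ∈ Finset.univ.filter
        (fun A : GL (Fin 2) (ZMod ℓ) =>
          Matrix.det (1 - (A : Matrix (Fin 2) (Fin 2) (ZMod ℓ))) = 0),
        quadraticChar (ZMod ℓ) (Matrix.det (A : Matrix (Fin 2) (Fin 2) (ZMod ℓ))))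
      = -(ℓ : ℤ) ∧
    (∑ A ∈ Finset.univ.filter
        (fun A : GL (Fin 2) (ZMod ℓ) =>
          Matrix.det (1 - (A : Matrix (Fin 2) (Fin 2) (ZMod ℓ))) ≠ 0),
        quadraticChar (ZMod ℓ) (Matrix.det (A : Matrix (Fin 2) (Fin 2) (ZMod ℓ))))
      = (ℓ : ℤ) := by
  have hF : ringChar (ZMod ℓ) ≠ 2 := by rwa [ZMod.ringChar_zmod_n]
  have h := sum_quadraticChar_det_GL_two_eigenvalue_one hF
  rw [ZMod.card] at h
  have htotal := sum_quadraticChar_det_GL_two hF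
  rw [← Finset.sum_filter_add_sum_filter_not Finset.univ
    (fun A : GL (Fin 2) (ZMod ℓ) =>
      Matrix.det (1 - (A : Matrix (Fin 2) (Fin 2) (ZMod ℓ))) = 0), h] at htotal
  exact ⟨h, by linarith⟩
end
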